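/- arXiv:1110.3810 — 4 statements merged into one kernel-verified Lean document; each statement's English description precedes it below -/
import Mathlib

section
/- Let δ ∈ ℕ∖{0}, n ∈ ℕ, and let N_n = Σ_{i=1}^n √(i(n+1−i)) x_{i+1} ∂/∂x_i on ℂ^{n+1}. Let d₀ : 𝒱_δ → 𝒱_δ be the Lie operator U ↦ [N_n, U] acting on the space 𝒱_δ of vector fields with homogeneous polynomial coefficients of degree δ+1, and let d₀* be its adjoint with respect to the Fischer inner product on 𝒱_δ. Then the triple (d₀, d₀*, D) with D = [d₀, d₀*] satisfies the sl(2,ℂ) relations [D, d₀] = 2d₀ and [D, d₀*] = −2d₀*, i.e. it defines a representation of sl(2,ℂ) on 𝒱_δ. -/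
open MvPolynomial

/-- The Fischer inner product on polynomials:
`⟨Σ a_α x^α, Σ b_β x^β⟩ = Σ_α a_α conj(b_α) α!/|α|!`. -/
noncomputable def fischerInner {σ : Type*} (P Q : MvPolynomial σ ℂ) : ℂ :=
  ∑ α ∈ P.support, P.coeff α * (starRingEnd ℂ) (Q.coeff α) *
    (((α.prod fun _ m => m.factorial : ℕ) : ℂ) / (((α.sum fun _ m => m).factorial : ℕ) : ℂ))

/-- The componentwise Fischer inner product on polynomial vector fields
`Σ_k V_k ∂/∂x_k`. -/
noncomputable def fischerInnerVF {σ : Type*} [Fintype σ]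
    (V W : σ → MvPolynomial σ ℂ) : ℂ :=
  ∑ k, fischerInner (V k) (W k)

/-- The Lie bracket of polynomial vector fields:
`[U, V]_i = Σ_j (U_j ∂V_i/∂x_j − V_j ∂U_i/∂x_j)`. -/
noncomputable def vfBracket {σ : Type*} [Fintype σ]
    (U V : σ → MvPolynomial σ ℂ) : σ → MvPolynomial σ ℂ :=
  fun i => ∑ j, (U j * pderiv j (V i) - V j * pderiv j (U i))

/-- A polynomial vector field is homogeneous of degree `d` (i.e. belongs to `𝒱_{d-1}`)
when each of its components is a homogeneous polynomial of degree `d`. -/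
def vfIsHomogeneous {σ : Type*} (V : σ → MvPolynomial σ ℂ) (d : ℕ) : Prop :=
  ∀ i, (V i).IsHomogeneous d

/-- The nilpotent vector field `N_n = Σ_{i=1}^n √(i(n+1−i)) x_{i+1} ∂/∂x_i`
on `ℂ^{n+1}` (0-based components). -/
noncomputable def nilVF (n : ℕ) : Fin (n + 1) → MvPolynomial (Fin (n + 1)) ℂ :=
  fun i => if h : (i : ℕ) < n then
    (((Real.sqrt ((((i : ℕ) + 1) * (n - (i : ℕ)) : ℕ) : ℝ) : ℝ) : ℂ)) •
      X (⟨(i : ℕ) + 1, by omega⟩ : Fin (n + 1))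
  else 0

section FischerAdjoint

variable {σ : Type*}

/-- The weight `α! / |α|!` of the Fischer inner product. -/
noncomputable def fischerWeight (α : σ →₀ ℕ) : ℂ :=
  ((α.prod fun _ m => m.factorial : ℕ) : ℂ) / (((α.sum fun _ m => m).factorial : ℕ) : ℂ)

lemma fischerWeight_ne_zero (α : σ →₀ ℕ) : fischerWeight α ≠ 0 := by
  unfold fischerWeight
  refine div_ne_zero (Nat.cast_ne_zero.2 ?_) (Nat.cast_ne_zero.2 (Nat.factorial_ne_zero _))
  exact Finset.prod_ne_zero_iff.2 fun i _ => Nat.factorial_ne_zero _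

lemma fischerWeight_add_single (γ : σ →₀ ℕ) (i : σ) :
    fischerWeight (γ + Finsupp.single i 1) =
      (γ i + 1) * ((γ.prod fun _ m => m.factorial : ℕ) : ℂ) /
        (((γ.sum fun _ m => m) + 1).factorial : ℕ) := by
  classical
  have hprod : ((γ + Finsupp.single i 1).prod fun _ m => m.factorial) =
      (γ i + 1) * γ.prod fun _ m => m.factorial := by
    have hs : ∀ β : σ →₀ ℕ, β.support ⊆ insert i γ.support →
        (β.prod fun _ m => m.factorial) = (β i).factorial *
          ∏ j ∈ (insert i γ.support).erase i, (β j).factorial := fun β hβ => by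
      rw [Finsupp.prod_of_support_subset β hβ _ (by simp),
        Finset.mul_prod_erase _ (fun j => (β j).factorial) (Finset.mem_insert_self _ _)]
    rw [hs γ (Finset.subset_insert _ _), hs (γ + Finsupp.single i 1)]
    · rw [← mul_assoc]
      congr 1
      · simp [Nat.factorial_succ]
      · refine Finset.prod_congr rfl fun j hj => ?_
        simp [(Finset.ne_of_mem_erase hj).symm]
    · intro j hj
      by_cases h : i = j
      · simp [h]
      · simpa [Finsupp.single_apply, h, Ne.symm h] using hj
  have hsum : ((γ + Finsupp.single i 1).sum fun _ m => m) = (γ.sum fun _ m => m) + 1 := by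
    rw [Finsupp.sum_add_index' (by simp) (by simp)]
    simp
  unfold fischerWeight
  rw [hprod, hsum]
  push_cast
  rfl

lemma fischerInner_eq_sum (P Q : MvPolynomial σ ℂ) {s : Finset (σ →₀ ℕ)} (hs : P.support ⊆ s) :
    fischerInner P Q =
      ∑ α ∈ s, P.coeff α * (starRingEnd ℂ) (Q.coeff α) * fischerWeight α :=
  Finset.sum_subset hs fun α _ hα => by simp [notMem_support_iff.1 hα]

/-- The Fischer inner product as a sesquilinear form. -/
noncomputable def fischerForm : MvPolynomial σ ℂ →ₗ[ℂ] MvPolynomial σ ℂ →ₗ⋆[ℂ] ℂ :=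
  LinearMap.mk₂'ₛₗ (RingHom.id ℂ) (starRingEnd ℂ) fischerInner
    (fun P₁ P₂ Q => by
      classical
      rw [fischerInner_eq_sum (P₁ + P₂) Q support_add,
        fischerInner_eq_sum P₁ Q Finset.subset_union_left,
        fischerInner_eq_sum P₂ Q Finset.subset_union_right, ← Finset.sum_add_distrib]
      exact Finset.sum_congr rfl fun α _ => by rw [coeff_add]; ring)
    (fun c P Q => by
      rw [fischerInner_eq_sum (c • P) Q support_smul, fischerInner_eq_sum P Q subset_rfl,
        Finset.smul_sum]
      exact Finset.sum_congr rfl fun α _ => by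
        simp only [coeff_smul, smul_eq_mul, RingHom.id_apply]; ring)
    (fun P Q₁ Q₂ => by
      simp only [fischerInner_eq_sum P _ subset_rfl, ← Finset.sum_add_distrib]
      exact Finset.sum_congr rfl fun α _ => by rw [coeff_add, map_add]; ring)
    (fun c P Q => by
      simp only [fischerInner_eq_sum P _ subset_rfl, Finset.smul_sum]
      exact Finset.sum_congr rfl fun α _ => by
        simp only [coeff_smul, smul_eq_mul, map_mul]; ring)

lemma fischerForm_apply (P Q : MvPolynomial σ ℂ) : fischerForm P Q = fischerInner P Q := rfl

lemma fischerForm_monomial_left (α : σ →₀ ℕ) (a : ℂ) (Q : MvPolynomial σ ℂ) :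
    fischerForm (monomial α a) Q = a * (starRingEnd ℂ) (Q.coeff α) * fischerWeight α := by
  classical
  rw [fischerForm_apply, fischerInner_eq_sum _ _ support_monomial_subset]
  simp [coeff_monomial]

lemma fischerForm_monomial_right (P : MvPolynomial σ ℂ) (β : σ →₀ ℕ) (b : ℂ) :
    fischerForm P (monomial β b) = P.coeff β * (starRingEnd ℂ) b * fischerWeight β := by
  classical
  rw [fischerForm_apply, fischerInner_eq_sum P _ (Finset.subset_insert β _),
    Finset.sum_eq_single_of_mem β (Finset.mem_insert_self _ _)]
  · simp
  · intro α _ hα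
    simp [coeff_monomial, hα.symm]

/-- `x_j ∂_i` and `x_i ∂_j` are adjoint for the Fischer inner product. -/
lemma fischerForm_X_mul_pderiv (i j : σ) (P Q : MvPolynomial σ ℂ) :
    fischerForm (X j * pderiv i P) Q = fischerForm P (X i * pderiv j Q) := by
  classical
  induction P using induction_on' with
  | add P₁ P₂ h₁ h₂ => simp only [map_add, mul_add, LinearMap.add_apply, h₁, h₂]
  | monomial α a =>
    induction Q using induction_on' with
    | add Q₁ Q₂ h₁ h₂ => simp only [map_add, mul_add, h₁, h₂]
    | monomial β b =>
      rw [fischerForm_monomial_left, fischerForm_monomial_right, pderiv_monomial,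
        pderiv_monomial, X, X, monomial_mul, monomial_mul, coeff_monomial, coeff_monomial]
      by_cases h : ∃ γ : σ →₀ ℕ, α = γ + Finsupp.single i 1 ∧ β = γ + Finsupp.single j 1
      · obtain ⟨γ, rfl, rfl⟩ := h
        simp only [add_tsub_cancel_right, add_comm (Finsupp.single _ 1) γ, if_true,
          Finsupp.add_apply, Finsupp.single_eq_same, fischerWeight_add_single]
        simp
        ring
      · have key : ∀ (α β : σ →₀ ℕ) (i j : σ),
            (¬ ∃ γ : σ →₀ ℕ, α = γ + Finsupp.single i 1 ∧ β = γ + Finsupp.single j 1) →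
            Finsupp.single j 1 + (α - Finsupp.single i 1) = β → α i = 0 := by
          intro α β i j hne hβ
          by_contra hα
          refine hne ⟨α - Finsupp.single i 1, ?_, by rw [← hβ, add_comm]⟩
          rw [tsub_add_cancel_of_le]
          simpa using Nat.one_le_iff_ne_zero.2 hα
        have h₁ := key α β i j h
        have h₂ := key β α j i fun ⟨γ, hβ, hα⟩ => h ⟨γ, hα, hβ⟩
        split_ifs with e₁ e₂ e₂ <;> simp_all

variable [Fintype σ]

/-- The linear vector field `x ↦ A x`. -/
noncomputable def linVF (A : Matrix σ σ ℂ) (i : σ) : MvPolynomial σ ℂ := ∑ j, A i j • X j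

/-- The Lie operator `U ↦ [A x, U]` of a linear vector field. -/
noncomputable def lieOp (A : Matrix σ σ ℂ) : (σ → MvPolynomial σ ℂ) →ₗ[ℂ] σ → MvPolynomial σ ℂ where
  toFun U i := mkDerivation ℂ (linVF A) (U i) - ∑ k, A i k • U k
  map_add' U V := by
    ext1 i
    simp only [Pi.add_apply, map_add, smul_add, Finset.sum_add_distrib]
    abel
  map_smul' c U := by
    ext1 i
    simp only [Pi.smul_apply, Derivation.map_smul, RingHom.id_apply, smul_sub, Finset.smul_sum,
      smul_comm c]

lemma lieOp_apply (A : Matrix σ σ ℂ) (U : σ → MvPolynomial σ ℂ) (i : σ) :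
    lieOp A U i = mkDerivation ℂ (linVF A) (U i) - ∑ k, A i k • U k := rfl

lemma mkDerivation_eq_sum_pderiv (f : σ → MvPolynomial σ ℂ) (P : MvPolynomial σ ℂ) :
    mkDerivation ℂ f P = ∑ j, f j * pderiv j P := by
  classical
  have h : mkDerivation ℂ f = ∑ j, f j • pderiv (R := ℂ) j := by
    refine derivation_ext fun i => ?_
    rw [mkDerivation_X, ← Derivation.coeFnAddMonoidHom_apply, map_sum, Finset.sum_apply]
    simp [pderiv_X, Pi.single_apply]
  rw [h, ← Derivation.coeFnAddMonoidHom_apply, map_sum, Finset.sum_apply]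
  simp

lemma mkDerivation_linVF (A : Matrix σ σ ℂ) (P : MvPolynomial σ ℂ) :
    mkDerivation ℂ (linVF A) P = ∑ i, ∑ j, A i j • (X j * pderiv i P) := by
  simp only [mkDerivation_eq_sum_pderiv, linVF, Finset.sum_mul, smul_mul_assoc]

lemma vfBracket_linVF (A : Matrix σ σ ℂ) (U : σ → MvPolynomial σ ℂ) :
    vfBracket (linVF A) U = lieOp A U := by
  classical
  ext1 i
  simp only [vfBracket, lieOp_apply, Finset.sum_sub_distrib, mkDerivation_eq_sum_pderiv]
  congr 1
  refine Finset.sum_congr rfl fun j _ => ?_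
  simp [linVF, pderiv_X, Pi.single_apply, smul_eq_C_mul, mul_comm]

lemma lieOp_smul (c : ℂ) (A : Matrix σ σ ℂ) : lieOp (c • A) = c • lieOp A := by
  ext1 U
  ext1 i
  simp only [lieOp_apply, LinearMap.smul_apply, Pi.smul_apply, mkDerivation_linVF,
    Matrix.smul_apply, smul_assoc, smul_sub, Finset.smul_sum]

lemma mkDerivation_linVF_comm (A B : Matrix σ σ ℂ) (P : MvPolynomial σ ℂ) :
    mkDerivation ℂ (linVF A) (mkDerivation ℂ (linVF B) P) -
      mkDerivation ℂ (linVF B) (mkDerivation ℂ (linVF A) P) =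
      mkDerivation ℂ (linVF (B * A - A * B)) P := by
  have hX : ∀ (A B : Matrix σ σ ℂ) (i : σ),
      mkDerivation ℂ (linVF A) (linVF B i) = linVF (B * A) i := by
    intro A B i
    simp only [linVF, map_sum, Derivation.map_smul, mkDerivation_X, Matrix.mul_apply, Finset.smul_sum,
      Finset.sum_smul, smul_smul]
    exact Finset.sum_comm
  have h : ⁅mkDerivation ℂ (linVF A), mkDerivation ℂ (linVF B)⁆ =
      mkDerivation ℂ (linVF (B * A - A * B)) := by
    refine derivation_ext fun i => ?_
    simp only [Derivation.commutator_apply, mkDerivation_X, hX]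
    simp only [linVF, Matrix.sub_apply, sub_smul, Finset.sum_sub_distrib]
  rw [← h, Derivation.commutator_apply]

/-- Linear vector fields bracket as `[A x, B x] = (B A - A B) x`, and so do their Lie operators. -/
lemma lieOp_comm (A B : Matrix σ σ ℂ) (U : σ → MvPolynomial σ ℂ) :
    lieOp A (lieOp B U) - lieOp B (lieOp A U) = lieOp (B * A - A * B) U := by
  have hmul : ∀ (A B : Matrix σ σ ℂ) (i : σ),
      ∑ k, A i k • ∑ l, B k l • U l = ∑ l, (A * B) i l • U l := by
    intro A B i
    simp only [Matrix.mul_apply, Finset.smul_sum, Finset.sum_smul, smul_smul]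
    exact Finset.sum_comm
  ext1 i
  simp only [Pi.sub_apply, lieOp_apply, map_sub, map_sum, Derivation.map_smul, smul_sub,
    Finset.sum_sub_distrib, hmul, ← mkDerivation_linVF_comm, Matrix.sub_apply, sub_smul]
  abel

lemma lieOp_isHomogeneous (A : Matrix σ σ ℂ) {U : σ → MvPolynomial σ ℂ} {d : ℕ}
    (hU : vfIsHomogeneous U (d + 1)) : vfIsHomogeneous (lieOp A U) (d + 1) := by
  intro i
  rw [lieOp_apply, mkDerivation_linVF]
  refine .sub (.sum _ _ _ fun k _ => .sum _ _ _ fun j _ => ?_) (.sum _ _ _ fun k _ => ?_)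
  · rw [smul_eq_C_mul]
    refine .C_mul ?_ _
    simpa [add_comm] using (isHomogeneous_X ℂ j).mul (hU i).pderiv
  · rw [smul_eq_C_mul]
    exact (hU k).C_mul _

/-- The Fischer adjoint of the Lie operator of `A x` is the Lie operator of `Aᴴ x`. -/
lemma fischerInnerVF_lieOp (A : Matrix σ σ ℂ) (V W : σ → MvPolynomial σ ℂ) :
    fischerInnerVF (lieOp A.conjTranspose V) W = fischerInnerVF V (lieOp A W) := by
  simp only [fischerInnerVF, ← fischerForm_apply, lieOp_apply, map_sub, LinearMap.sub_apply,
    Finset.sum_sub_distrib, mkDerivation_linVF, map_sum, LinearMap.sum_apply, map_smul,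
    LinearMap.smul_apply, LinearMap.map_smulₛₗ, fischerForm_X_mul_pderiv,
    Matrix.conjTranspose_apply]
  congr 1
  · exact Finset.sum_congr rfl fun k _ => Finset.sum_comm
  · exact Finset.sum_comm

/-- A homogeneous vector field is determined by its Fischer products with homogeneous ones. -/
lemma eq_of_fischerInnerVF_eq {V V' : σ → MvPolynomial σ ℂ} {d : ℕ}
    (hV : vfIsHomogeneous V d) (hV' : vfIsHomogeneous V' d)
    (h : ∀ W, vfIsHomogeneous W d → fischerInnerVF V W = fischerInnerVF V' W) : V = V' := by
  classical
  ext1 k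
  ext β
  by_cases hβ : β.degree = d
  · have hsum : ∀ U : σ → MvPolynomial σ ℂ,
        fischerInnerVF U (Pi.single k (monomial β 1)) = (U k).coeff β * fischerWeight β := by
      intro U
      simp only [fischerInnerVF, ← fischerForm_apply]
      rw [Finset.sum_eq_single_of_mem k (Finset.mem_univ _)]
      · simp [fischerForm_monomial_right]
      · intro j _ hj
        simp [hj]
    have hW : vfIsHomogeneous (Pi.single k (monomial β (1 : ℂ)) : σ → MvPolynomial σ ℂ) d := by
      intro j
      by_cases hj : j = k
      · subst hj
        simpa using isHomogeneous_monomial (1 : ℂ) hβ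
      · simpa [hj] using isHomogeneous_zero σ ℂ d
    have := h _ hW
    rw [hsum, hsum] at this
    exact mul_right_cancel₀ (fischerWeight_ne_zero β) this
  · rw [(hV k).coeff_eq_zero hβ, (hV' k).coeff_eq_zero hβ]

end FischerAdjoint

/-- The matrix of the linear vector field `nilVF n`. -/
noncomputable def nilMatrix (n : ℕ) : Matrix (Fin (n + 1)) (Fin (n + 1)) ℂ :=
  fun i j => if (j : ℕ) = i + 1 then ((√((((i : ℕ) + 1) * (n - i) : ℕ) : ℝ) : ℝ) : ℂ) else 0

lemma nilVF_eq_linVF (n : ℕ) : nilVF n = linVF (nilMatrix n) := by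
  ext1 i
  simp only [nilVF, linVF, nilMatrix, ite_smul, zero_smul]
  split_ifs with h
  · rw [Finset.sum_eq_single_of_mem ⟨i + 1, by omega⟩ (Finset.mem_univ _)]
    · simp
    · intro j _ hj
      exact if_neg fun e => hj (Fin.ext e)
  · exact (Finset.sum_eq_zero fun j _ => if_neg (by omega)).symm

lemma nilMatrix_mul_star (n : ℕ) (i j : Fin (n + 1)) :
    nilMatrix n i j * star (nilMatrix n i j) =
      if (j : ℕ) = i + 1 then (((i : ℕ) : ℂ) + 1) * (n - (i : ℕ)) else 0 := by
  unfold nilMatrix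
  split_ifs with h
  · rw [Complex.star_def, Complex.conj_ofReal, ← Complex.ofReal_mul,
      Real.mul_self_sqrt (Nat.cast_nonneg _)]
    push_cast [Nat.cast_sub (Fin.is_le i)]
    rfl
  · simp

lemma nilMatrix_mul_conjTranspose (n : ℕ) :
    nilMatrix n * (nilMatrix n).conjTranspose =
      Matrix.diagonal fun i : Fin (n + 1) => (((i : ℕ) : ℂ) + 1) * (n - (i : ℕ)) := by
  ext i k
  rw [Matrix.mul_apply]
  simp only [Matrix.conjTranspose_apply]
  by_cases hik : i = k
  · subst hik
    simp only [nilMatrix_mul_star, Matrix.diagonal_apply_eq]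
    by_cases hi : (i : ℕ) < n
    · rw [Finset.sum_eq_single_of_mem ⟨i + 1, by omega⟩ (Finset.mem_univ _)]
      · simp
      · intro j _ hj
        exact if_neg fun e => hj (Fin.ext e)
    · have : (i : ℕ) = n := by omega
      rw [Finset.sum_eq_zero fun j _ => if_neg (by omega)]
      simp [this]
  · rw [Matrix.diagonal_apply_ne _ hik]
    refine Finset.sum_eq_zero fun j _ => ?_
    unfold nilMatrix
    split_ifs <;> first | omega | simp

lemma nilMatrix_conjTranspose_mul (n : ℕ) :
    (nilMatrix n).conjTranspose * nilMatrix n =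
      Matrix.diagonal fun i : Fin (n + 1) => ((i : ℕ) : ℂ) * (n + 1 - (i : ℕ)) := by
  ext i k
  rw [Matrix.mul_apply]
  simp only [Matrix.conjTranspose_apply]
  by_cases hik : i = k
  · subst hik
    simp only [mul_comm (star _), nilMatrix_mul_star, Matrix.diagonal_apply_eq]
    by_cases hi : 0 < (i : ℕ)
    · rw [Finset.sum_eq_single_of_mem ⟨i - 1, by omega⟩ (Finset.mem_univ _)]
      · simp only [Nat.sub_add_cancel hi, if_true, Nat.cast_sub hi]
        push_cast
        ring
      · intro j _ hj
        exact if_neg fun e => hj (Fin.ext (by simp; omega))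
    · have : (i : ℕ) = 0 := by omega
      rw [Finset.sum_eq_zero fun j _ => if_neg (by omega)]
      simp [this]
  · rw [Matrix.diagonal_apply_ne _ hik]
    refine Finset.sum_eq_zero fun j _ => ?_
    unfold nilMatrix
    split_ifs <;> first | omega | simp

/-- The weight matrix of the `sl₂`-triple spanned by `nilMatrix n` and its conjugate transpose. -/
lemma nilMatrix_comm (n : ℕ) :
    (nilMatrix n).conjTranspose * nilMatrix n - nilMatrix n * (nilMatrix n).conjTranspose =
      Matrix.diagonal fun i : Fin (n + 1) => 2 * ((i : ℕ) : ℂ) - n := by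
  rw [nilMatrix_mul_conjTranspose, nilMatrix_conjTranspose_mul, Matrix.diagonal_sub]
  congr 1
  ext1 i
  ring

lemma nilMatrix_mul_diagonal_sub (n : ℕ) :
    nilMatrix n * Matrix.diagonal (fun i : Fin (n + 1) => 2 * ((i : ℕ) : ℂ) - n) -
      Matrix.diagonal (fun i : Fin (n + 1) => 2 * ((i : ℕ) : ℂ) - n) * nilMatrix n =
      (2 : ℂ) • nilMatrix n := by
  ext i j
  simp only [Matrix.sub_apply, Matrix.mul_diagonal, Matrix.diagonal_mul, Matrix.smul_apply,
    smul_eq_mul]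
  by_cases h : (j : ℕ) = i + 1
  · rw [h]
    push_cast
    ring
  · simp [nilMatrix, h]

lemma nilMatrix_conjTranspose_mul_diagonal_sub (n : ℕ) :
    (nilMatrix n).conjTranspose * Matrix.diagonal (fun i : Fin (n + 1) => 2 * ((i : ℕ) : ℂ) - n) -
      Matrix.diagonal (fun i : Fin (n + 1) => 2 * ((i : ℕ) : ℂ) - n) * (nilMatrix n).conjTranspose =
      (-2 : ℂ) • (nilMatrix n).conjTranspose := by
  ext i j
  simp only [Matrix.sub_apply, Matrix.mul_diagonal, Matrix.diagonal_mul, Matrix.smul_apply,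
    smul_eq_mul, Matrix.conjTranspose_apply]
  by_cases h : (i : ℕ) = j + 1
  · rw [h]
    push_cast
    ring
  · simp [nilMatrix, h]

/-- Let `δ ≥ 1` and let `d₀ : 𝒱_δ → 𝒱_δ`, `U ↦ [N_n, U]`, be the Lie
operator on the space `𝒱_δ` of vector fields with homogeneous coefficients of degree
`δ+1`, and `d₀*` its adjoint with respect to the Fischer inner product (characterized by
`⟨d₀* V, W⟩ = ⟨V, d₀ W⟩` on `𝒱_δ`, preserving `𝒱_δ`).  Then with `D = [d₀, d₀*]` the
triple satisfies the sl(2,ℂ) relations `[D, d₀] = 2d₀` and `[D, d₀*] = −2d₀*` on `𝒱_δ`. -/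
theorem stmt_6 (n : ℕ) (δ : ℕ) (hδ : 1 ≤ δ)
    (d₀ : (Fin (n + 1) → MvPolynomial (Fin (n + 1)) ℂ) →ₗ[ℂ]
      (Fin (n + 1) → MvPolynomial (Fin (n + 1)) ℂ))
    (hd₀ : ∀ U, d₀ U = vfBracket (nilVF n) U)
    (d₀star : (Fin (n + 1) → MvPolynomial (Fin (n + 1)) ℂ) →ₗ[ℂ]
      (Fin (n + 1) → MvPolynomial (Fin (n + 1)) ℂ))
    (hpres : ∀ V, vfIsHomogeneous V (δ + 1) → vfIsHomogeneous (d₀star V) (δ + 1))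
    (hadj : ∀ V W, vfIsHomogeneous V (δ + 1) → vfIsHomogeneous W (δ + 1) →
      fischerInnerVF (d₀star V) W = fischerInnerVF V (d₀ W))
    (D : (Fin (n + 1) → MvPolynomial (Fin (n + 1)) ℂ) →ₗ[ℂ]
      (Fin (n + 1) → MvPolynomial (Fin (n + 1)) ℂ))
    (hD : D = d₀ ∘ₗ d₀star - d₀star ∘ₗ d₀) :
    ∀ U, vfIsHomogeneous U (δ + 1) →
      (D ∘ₗ d₀ - d₀ ∘ₗ D) U = (2 : ℂ) • d₀ U ∧
      (D ∘ₗ d₀star - d₀star ∘ₗ D) U = (-2 : ℂ) • d₀star U := by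
  have hd : d₀ = lieOp (nilMatrix n) :=
    LinearMap.ext fun U => by rw [hd₀, nilVF_eq_linVF, vfBracket_linVF]
  have hs : ∀ V, vfIsHomogeneous V (δ + 1) →
      d₀star V = lieOp (nilMatrix n).conjTranspose V := fun V hV =>
    eq_of_fischerInnerVF_eq (hpres V hV) (lieOp_isHomogeneous _ hV) fun W hW => by
      rw [hadj V W hV hW, fischerInnerVF_lieOp, hd]
  have hDeq : ∀ V, vfIsHomogeneous V (δ + 1) →
      D V = lieOp (Matrix.diagonal fun i : Fin (n + 1) => 2 * ((i : ℕ) : ℂ) - n) V := fun V hV => by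
    rw [← nilMatrix_comm, ← lieOp_comm, hD, LinearMap.sub_apply, LinearMap.comp_apply,
      LinearMap.comp_apply, hd, hs V hV, hs _ (lieOp_isHomogeneous _ hV)]
  intro U hU
  simp only [LinearMap.sub_apply, LinearMap.comp_apply]
  constructor
  · rw [hd, hDeq _ (lieOp_isHomogeneous _ hU), hDeq U hU, lieOp_comm,
      nilMatrix_mul_diagonal_sub, lieOp_smul, LinearMap.smul_apply]
  · rw [hs U hU, hDeq _ (lieOp_isHomogeneous _ hU), hDeq U hU, hs _ (lieOp_isHomogeneous _ hU),
      lieOp_comm, nilMatrix_conjTranspose_mul_diagonal_sub, lieOp_smul, LinearMap.smul_apply]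
end

section
/- Let n ∈ ℕ, α_i = √(i(n+1−i)) for 1 ≤ i ≤ n, and let N, M, H be square matrices of the same size m over ℂ satisfying the sl(2,ℂ) relations [H,N] = 2N, [H,M] = −2M, [N,M] = H. Define the (n+1)×(n+1) block matrices (each block of size m): d₀ with diagonal blocks equal to N and block (i, i+1) equal to −α_i I for 1 ≤ i ≤ n (zeros elsewhere), and d₀* with diagonal blocks equal to M and block (i+1, i) equal to −α_i I for 1 ≤ i ≤ n (zeros elsewhere). Then D = [d₀, d₀*] satisfies [D, d₀] = 2d₀ and [D, d₀*] = −2d₀*, so the triple (d₀, d₀*, D) satisfies the sl(2,ℂ) relations. -/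
open Matrix

/-- The coefficients `α_i = √(i(n+1−i))` for `1 ≤ i ≤ n`, with the convention that
`α_i = 0` outside this range (in particular `α₀ = α_{n+1} = 0`). -/
noncomputable def nilCoeff (n : ℕ) (i : ℕ) : ℂ :=
  if 1 ≤ i ∧ i ≤ n then ((Real.sqrt ((i * (n + 1 - i) : ℕ) : ℝ) : ℝ) : ℂ) else 0

open scoped Kronecker

theorem nilCoeff_mul_self {n i : ℕ} (hi : i ≤ n + 1) :
    nilCoeff n i * nilCoeff n i = (i : ℂ) * ((n : ℂ) + 1 - i) := by
  unfold nilCoeff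
  split_ifs with h
  · rw [← Complex.ofReal_mul, Real.mul_self_sqrt (by positivity)]
    push_cast [Nat.cast_sub hi]
    ring
  · have : i = 0 ∨ i = n + 1 := by omega
    rcases this with rfl | rfl <;> simp

/-- The superdiagonal matrix with entries `-α_i`. -/
noncomputable def nilRaise (n : ℕ) : Matrix (Fin (n + 1)) (Fin (n + 1)) ℂ :=
  Matrix.of fun i j => if (j : ℕ) = (i : ℕ) + 1 then -nilCoeff n ((i : ℕ) + 1) else 0

/-- The diagonal matrix of weights `n - 2 i` for `0 ≤ i ≤ n`. -/
def weightMatrix (n : ℕ) : Matrix (Fin (n + 1)) (Fin (n + 1)) ℂ :=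
  Matrix.diagonal fun i => (n : ℂ) - 2 * ((i : ℕ) : ℂ)

theorem nilRaise_mul_transpose (n : ℕ) :
    nilRaise n * (nilRaise n)ᵀ = Matrix.diagonal fun i : Fin (n + 1) =>
      nilCoeff n ((i : ℕ) + 1) * nilCoeff n ((i : ℕ) + 1) := by
  ext i j
  simp only [Matrix.mul_apply, nilRaise, Matrix.transpose_apply, Matrix.of_apply,
    Matrix.diagonal_apply, Fin.ext_iff]
  rw [Fin.sum_univ_eq_sum_range (fun k : ℕ =>
    (if k = (i : ℕ) + 1 then -nilCoeff n ((i : ℕ) + 1) else 0) *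
    (if k = (j : ℕ) + 1 then -nilCoeff n ((j : ℕ) + 1) else 0)) (n + 1)]
  simp only [ite_mul, zero_mul, Finset.sum_ite_eq', Finset.mem_range, add_left_inj]
  split_ifs with h₁ h₂ h₂
  · rw [h₂]; ring
  · simp
  · have : nilCoeff n ((i : ℕ) + 1) = 0 := if_neg (by omega)
    simp [this]
  · rfl

theorem transpose_mul_nilRaise (n : ℕ) :
    (nilRaise n)ᵀ * nilRaise n = Matrix.diagonal fun i : Fin (n + 1) =>
      nilCoeff n i * nilCoeff n i := by
  ext i j
  simp only [Matrix.mul_apply, nilRaise, Matrix.transpose_apply, Matrix.of_apply,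
    Matrix.diagonal_apply, Fin.ext_iff]
  rw [Fin.sum_univ_eq_sum_range (fun k : ℕ =>
    (if (i : ℕ) = k + 1 then -nilCoeff n (k + 1) else 0) *
    (if (j : ℕ) = k + 1 then -nilCoeff n (k + 1) else 0)) (n + 1)]
  obtain ⟨i, hi⟩ := i
  cases i with
  | zero => simp [nilCoeff]
  | succ i =>
    have : i < n + 1 := by omega
    simp only [add_left_inj, ite_mul, zero_mul, Finset.sum_ite_eq, Finset.mem_range, this,
      if_true, eq_comm (a := (j : ℕ))]
    split_ifs <;> simp

theorem nilRaise_commutator_transpose (n : ℕ) :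
    nilRaise n * (nilRaise n)ᵀ - (nilRaise n)ᵀ * nilRaise n = weightMatrix n := by
  rw [nilRaise_mul_transpose, transpose_mul_nilRaise, Matrix.diagonal_sub, weightMatrix]
  congr 1
  funext i
  rw [nilCoeff_mul_self (by omega), nilCoeff_mul_self (by omega)]
  push_cast
  ring

theorem weightMatrix_commutator_nilRaise (n : ℕ) :
    weightMatrix n * nilRaise n - nilRaise n * weightMatrix n = (2 : ℂ) • nilRaise n := by
  ext i j
  simp only [weightMatrix, nilRaise, Matrix.sub_apply, Matrix.diagonal_mul,
    Matrix.mul_diagonal, Matrix.of_apply, Matrix.smul_apply, smul_eq_mul]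
  split_ifs with h
  · rw [h]; push_cast; ring
  · simp

theorem weightMatrix_commutator_transpose (n : ℕ) :
    weightMatrix n * (nilRaise n)ᵀ - (nilRaise n)ᵀ * weightMatrix n =
      (-2 : ℂ) • (nilRaise n)ᵀ := by
  have h := congrArg Matrix.transpose (weightMatrix_commutator_nilRaise n)
  have hw : (weightMatrix n)ᵀ = weightMatrix n := Matrix.diagonal_transpose _
  rw [Matrix.transpose_sub, Matrix.transpose_mul, Matrix.transpose_mul, hw,
    Matrix.transpose_smul] at h
  rw [neg_smul, ← h, neg_sub]

/-- The commutator of two Kronecker sums is the Kronecker sum of the commutators. -/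
theorem kroneckerSum_commutator {p q R : Type*} [Fintype p] [Fintype q] [DecidableEq p]
    [DecidableEq q] [CommRing R] (A B : Matrix p p R) (X Y : Matrix q q R) :
    ((1 : Matrix p p R) ⊗ₖ X + A ⊗ₖ (1 : Matrix q q R)) * (1 ⊗ₖ Y + B ⊗ₖ 1) -
      (1 ⊗ₖ Y + B ⊗ₖ 1) * (1 ⊗ₖ X + A ⊗ₖ 1) =
      1 ⊗ₖ (X * Y - Y * X) + (A * B - B * A) ⊗ₖ 1 := by
  have hl : (1 : Matrix p p R) ⊗ₖ (X * Y - Y * X) = 1 ⊗ₖ (X * Y) - 1 ⊗ₖ (Y * X) := by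
    ext
    simp [mul_sub]
  have hr : (A * B - B * A) ⊗ₖ (1 : Matrix q q R) = (A * B) ⊗ₖ 1 - (B * A) ⊗ₖ 1 := by
    ext
    simp [sub_mul]
  rw [hl, hr]
  simp only [add_mul, mul_add, ← Matrix.mul_kronecker_mul, one_mul, mul_one]
  abel

/-- Let `N, M, H` be `m×m` matrices satisfying the sl(2,ℂ) relations.
Form the `(n+1)×(n+1)` block matrices (blocks of size `m`, identified with matrices
indexed by `Fin (n+1) × Fin m`): `d₀` with diagonal blocks `N` and block `(i, i+1)`
equal to `−α_i I`, and `d₀*` with diagonal blocks `M` and block `(i+1, i)` equal to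
`−α_i I`.  Then `D = [d₀, d₀*]` satisfies `[D, d₀] = 2d₀` and `[D, d₀*] = −2d₀*`. -/
theorem stmt_7 (n m : ℕ) (N M H : Matrix (Fin m) (Fin m) ℂ)
    (rel1 : H * N - N * H = (2 : ℂ) • N)
    (rel2 : H * M - M * H = (-2 : ℂ) • M)
    (rel3 : N * M - M * N = H)
    (d₀ d₀star D : Matrix (Fin (n + 1) × Fin m) (Fin (n + 1) × Fin m) ℂ)
    (hd₀ : d₀ = Matrix.of fun x y : Fin (n + 1) × Fin m =>
      if y.1 = x.1 then N x.2 y.2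
      else if (y.1 : ℕ) = (x.1 : ℕ) + 1 then
        -nilCoeff n ((x.1 : ℕ) + 1) * (1 : Matrix (Fin m) (Fin m) ℂ) x.2 y.2
      else 0)
    (hd₀star : d₀star = Matrix.of fun x y : Fin (n + 1) × Fin m =>
      if y.1 = x.1 then M x.2 y.2
      else if (x.1 : ℕ) = (y.1 : ℕ) + 1 then
        -nilCoeff n ((y.1 : ℕ) + 1) * (1 : Matrix (Fin m) (Fin m) ℂ) x.2 y.2
      else 0)
    (hD : D = d₀ * d₀star - d₀star * d₀) :
    D * d₀ - d₀ * D = (2 : ℂ) • d₀ ∧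
    D * d₀star - d₀star * D = (-2 : ℂ) • d₀star := by
  have h₀ : d₀ = 1 ⊗ₖ N + nilRaise n ⊗ₖ 1 := by
    rw [hd₀]
    ext ⟨i, a⟩ ⟨j, b⟩
    by_cases h : j = i
    · subst h
      simp [nilRaise]
    · simp [nilRaise, Matrix.one_apply_ne' h, h]
  have h₁ : d₀star = 1 ⊗ₖ M + (nilRaise n)ᵀ ⊗ₖ 1 := by
    rw [hd₀star]
    ext ⟨i, a⟩ ⟨j, b⟩
    by_cases h : j = i
    · subst h
      simp [nilRaise]
    · simp [nilRaise, Matrix.one_apply_ne' h, h]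
  have h₂ : D = 1 ⊗ₖ H + weightMatrix n ⊗ₖ 1 := by
    rw [hD, h₀, h₁, kroneckerSum_commutator, rel3, nilRaise_commutator_transpose]
  rw [h₂, h₀, h₁, kroneckerSum_commutator, kroneckerSum_commutator, rel1, rel2,
    weightMatrix_commutator_nilRaise, weightMatrix_commutator_transpose]
  simp only [Matrix.kronecker_smul, Matrix.smul_kronecker, smul_add, and_self]
end

section
/- Let n ∈ ℕ, α_i = √(i(n+1−i)) for 1 ≤ i ≤ n, with the convention α₀ = α_{n+1} = 0, and let N, M, H be square m×m matrices over ℂ with [N,M] = H. Define the block matrices d₀ (diagonal blocks N, blocks (i, i+1) equal to −α_i I) and d₀* (diagonal blocks M, blocks (i+1, i) equal to −α_i I) as (n+1)×(n+1) block matrices with m×m blocks. Then D = [d₀, d₀*] is block diagonal, with i-th diagonal block equal to H + (α_i² − α_{i−1}²) I for 1 ≤ i ≤ n+1 (so the first block is H + α₁² I and the last block is H − α_n² I). -/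
open Matrix

open scoped Kronecker in
/-- In the commutator of `1 ⊗ N - A ⊗ 1` and `1 ⊗ M - B ⊗ 1` only the commutators within each
tensor factor survive. -/
theorem kronecker_sub_commutator {ι κ R : Type*} [Fintype ι] [DecidableEq ι] [Fintype κ]
    [DecidableEq κ] [CommRing R] (A B : Matrix ι ι R) (N M : Matrix κ κ R) :
    ((1 : Matrix ι ι R) ⊗ₖ N - A ⊗ₖ (1 : Matrix κ κ R)) *
        ((1 : Matrix ι ι R) ⊗ₖ M - B ⊗ₖ (1 : Matrix κ κ R)) -
      ((1 : Matrix ι ι R) ⊗ₖ M - B ⊗ₖ (1 : Matrix κ κ R)) *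
        ((1 : Matrix ι ι R) ⊗ₖ N - A ⊗ₖ (1 : Matrix κ κ R)) =
      (1 : Matrix ι ι R) ⊗ₖ (N * M - M * N) + (A * B - B * A) ⊗ₖ (1 : Matrix κ κ R) := by
  have hl : (1 : Matrix ι ι R) ⊗ₖ (N * M - M * N) =
      (1 : Matrix ι ι R) ⊗ₖ (N * M) - (1 : Matrix ι ι R) ⊗ₖ (M * N) := by
    ext; simp [mul_sub]
  have hr : (A * B - B * A) ⊗ₖ (1 : Matrix κ κ R) =
      (A * B) ⊗ₖ (1 : Matrix κ κ R) - (B * A) ⊗ₖ (1 : Matrix κ κ R) := by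
    ext; simp [sub_mul]
  rw [hl, hr]
  simp only [mul_sub, sub_mul, ← mul_kronecker_mul, one_mul, mul_one]
  abel

/-- The scalar shift matrix with entry `α_i` in position `(i, i+1)`. -/
noncomputable def nilShift (n : ℕ) : Matrix (Fin (n + 1)) (Fin (n + 1)) ℂ :=
  Matrix.of fun i j => if (j : ℕ) = (i : ℕ) + 1 then nilCoeff n ((i : ℕ) + 1) else 0

theorem nilShift_mul_transpose (n : ℕ) :
    nilShift n * (nilShift n)ᵀ =
      Matrix.diagonal fun i : Fin (n + 1) => nilCoeff n ((i : ℕ) + 1) ^ 2 := by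
  ext i j
  simp only [mul_apply, transpose_apply, nilShift, of_apply, diagonal_apply]
  by_cases hi : (i : ℕ) < n
  · rw [Finset.sum_eq_single ⟨(i : ℕ) + 1, by omega⟩]
    · by_cases hij : i = j
      · subst hij; simp [sq]
      · have : ¬ (i : ℕ) = j := fun h => hij (Fin.ext h)
        simp [hij, this]
    · intro k _ hk
      have : ¬ (k : ℕ) = (i : ℕ) + 1 := fun h => hk (Fin.ext h)
      simp [this]
    · simp
  · have h0 : nilCoeff n ((i : ℕ) + 1) = 0 := if_neg (by omega)
    simp [h0]

theorem transpose_mul_nilShift (n : ℕ) :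
    (nilShift n)ᵀ * nilShift n =
      Matrix.diagonal fun i : Fin (n + 1) => nilCoeff n (i : ℕ) ^ 2 := by
  ext i j
  simp only [mul_apply, transpose_apply, nilShift, of_apply, diagonal_apply]
  by_cases hi : (i : ℕ) = 0
  · have h0 : nilCoeff n (i : ℕ) = 0 := if_neg (by omega)
    simp [hi ▸ h0, hi]
  · have hs : (i : ℕ) - 1 + 1 = i := by omega
    rw [Finset.sum_eq_single ⟨(i : ℕ) - 1, by omega⟩]
    · by_cases hij : i = j
      · subst hij; simp [hs, sq]
      · have : ¬ (j : ℕ) = i := fun h => hij (Fin.ext h.symm)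
        simp [hs, hij, this]
    · intro k _ hk
      have : ¬ (i : ℕ) = (k : ℕ) + 1 := fun h => hk (Fin.ext (by simp; omega))
      simp [this]
    · simp

/-- Let `N, M, H` be `m×m` matrices with `[N,M] = H`, and let
`α_i = √(i(n+1−i))` (with `α₀ = α_{n+1} = 0`).  Form the `(n+1)×(n+1)` block matrices
`d₀` (diagonal blocks `N`, block `(i,i+1)` equal to `−α_i I`) and `d₀*` (diagonal blocks
`M`, block `(i+1,i)` equal to `−α_i I`).  Then `D = [d₀, d₀*]` is block diagonal with
`i`-th diagonal block `H + (α_i² − α_{i−1}²) I` for `1 ≤ i ≤ n+1` (1-based). -/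
theorem stmt_8 (n m : ℕ) (N M H : Matrix (Fin m) (Fin m) ℂ)
    (rel3 : N * M - M * N = H)
    (d₀ d₀star : Matrix (Fin (n + 1) × Fin m) (Fin (n + 1) × Fin m) ℂ)
    (hd₀ : d₀ = Matrix.of fun x y : Fin (n + 1) × Fin m =>
      if y.1 = x.1 then N x.2 y.2
      else if (y.1 : ℕ) = (x.1 : ℕ) + 1 then
        -nilCoeff n ((x.1 : ℕ) + 1) * (1 : Matrix (Fin m) (Fin m) ℂ) x.2 y.2
      else 0)
    (hd₀star : d₀star = Matrix.of fun x y : Fin (n + 1) × Fin m =>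
      if y.1 = x.1 then M x.2 y.2
      else if (x.1 : ℕ) = (y.1 : ℕ) + 1 then
        -nilCoeff n ((y.1 : ℕ) + 1) * (1 : Matrix (Fin m) (Fin m) ℂ) x.2 y.2
      else 0) :
    d₀ * d₀star - d₀star * d₀ =
      Matrix.of fun x y : Fin (n + 1) × Fin m =>
        if y.1 = x.1 then
          (H + ((nilCoeff n ((x.1 : ℕ) + 1)) ^ 2 - (nilCoeff n (x.1 : ℕ)) ^ 2) •
            (1 : Matrix (Fin m) (Fin m) ℂ)) x.2 y.2
        else 0 := by
  have h₀ : d₀ = kroneckerMap (· * ·) (1 : Matrix (Fin (n + 1)) (Fin (n + 1)) ℂ) N -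
      kroneckerMap (· * ·) (nilShift n) (1 : Matrix (Fin m) (Fin m) ℂ) := by
    rw [hd₀]
    ext ⟨i, a⟩ ⟨j, b⟩
    by_cases hij : j = i
    · subst hij; simp [nilShift]
    · by_cases hs : (j : ℕ) = (i : ℕ) + 1 <;> simp [nilShift, hij, Ne.symm hij, hs]
  have h₁ : d₀star = kroneckerMap (· * ·) (1 : Matrix (Fin (n + 1)) (Fin (n + 1)) ℂ) M -
      kroneckerMap (· * ·) (nilShift n)ᵀ (1 : Matrix (Fin m) (Fin m) ℂ) := by
    rw [hd₀star]
    ext ⟨i, a⟩ ⟨j, b⟩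
    by_cases hij : j = i
    · subst hij; simp [nilShift]
    · by_cases hs : (i : ℕ) = (j : ℕ) + 1 <;> simp [nilShift, hij, Ne.symm hij, hs]
  rw [h₀, h₁, kronecker_sub_commutator, rel3, nilShift_mul_transpose, transpose_mul_nilShift]
  ext ⟨i, a⟩ ⟨j, b⟩
  by_cases hij : j = i
  · subst hij; simp
  · simp [hij, Ne.symm hij]
end

section
/- Let V be a finite-dimensional complex vector space and let e, f, h be linear endomorphisms of V satisfying the sl(2,ℂ) relations [h,e] = 2e, [h,f] = −2f, [e,f] = h (so that V is a finite-dimensional representation of sl(2,ℂ)). Then every nonzero eigenvalue of the composed operator e∘f is a positive integer. -/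
/-- In finite dimension, a sequence of vectors on which an endomorphism acts by pairwise distinct
scalars must contain the zero vector. -/
lemma Module.End.exists_eq_zero_of_apply_eq_smul {K V : Type*} [Field K] [AddCommGroup V]
    [Module K V] [FiniteDimensional K V] (T : Module.End K V) (a : ℕ → K)
    (ha : Function.Injective a) (u : ℕ → V) (hu : ∀ k, T (u k) = a k • u k) : ∃ k, u k = 0 := by
  by_contra! hne
  have hli : LinearIndependent K u := T.eigenvectors_linearIndependent' a ha u fun k ↦
    Module.End.hasEigenvector_iff.mpr ⟨Module.End.mem_eigenspace_iff.mpr (hu k), hne k⟩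
  have := hli.finite
  exact not_finite ℕ

/-- An endomorphism commuting with `S` shares an eigenvector with `S` in each eigenspace of `S`. -/
lemma Module.End.HasEigenvalue.exists_common_eigenvector {K V : Type*} [Field K] [IsAlgClosed K]
    [AddCommGroup V] [Module K V] [FiniteDimensional K V] {S T : Module.End K V} {μ : K}
    (hμ : S.HasEigenvalue μ) (hST : Commute S T) :
    ∃ (c : K) (v : V), v ≠ 0 ∧ S v = μ • v ∧ T v = c • v := by
  have hmaps : ∀ v ∈ S.eigenspace μ, T v ∈ S.eigenspace μ :=
    Module.End.mapsTo_genEigenspace_of_comm hST μ 1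
  have : Nontrivial (S.eigenspace μ) := Submodule.nontrivial_iff_ne_bot.mpr hμ
  obtain ⟨c, hc⟩ := Module.End.exists_eigenvalue (T.restrict hmaps)
  obtain ⟨⟨v, hv⟩, hvec⟩ := hc.exists_hasEigenvector
  exact ⟨c, v, fun h0 ↦ hvec.2 (Subtype.ext h0), Module.End.mem_eigenspace_iff.mp hv,
    congrArg Subtype.val hvec.apply_eq_smul⟩

/-- If `e, f, h` are endomorphisms of a finite-dimensional complex vector
space satisfying the sl(2,ℂ) relations `[h,e] = 2e`, `[h,f] = −2f`, `[e,f] = h`, then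
every nonzero eigenvalue of `e ∘ f` is a positive integer. -/
theorem stmt_11 (V : Type*) [AddCommGroup V] [Module ℂ V] [FiniteDimensional ℂ V]
    (e f h : Module.End ℂ V)
    (rel1 : h ∘ₗ e - e ∘ₗ h = (2 : ℂ) • e)
    (rel2 : h ∘ₗ f - f ∘ₗ h = (-2 : ℂ) • f)
    (rel3 : e ∘ₗ f - f ∘ₗ e = h) :
    ∀ μ : ℂ, Module.End.HasEigenvalue (e ∘ₗ f) μ → μ ≠ 0 →
      ∃ k : ℕ, 0 < k ∧ μ = (k : ℂ) := by
  intro μ hμ hμ0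
  have he (x : V) : h (e x) = e (h x) + (2 : ℂ) • e x :=
    sub_eq_iff_eq_add'.mp (LinearMap.congr_fun rel1 x)
  have hf (x : V) : h (f x) = f (h x) + (-2 : ℂ) • f x :=
    sub_eq_iff_eq_add'.mp (LinearMap.congr_fun rel2 x)
  have hef (x : V) : e (f x) = f (e x) + h x :=
    sub_eq_iff_eq_add'.mp (LinearMap.congr_fun rel3 x)
  have hcomm : Commute (e ∘ₗ f) h := by
    ext x
    simp [he, hf]
  obtain ⟨c, v, hv0, hv, hc⟩ := hμ.exists_common_eigenvector hcomm
  replace hv : e (f v) = μ • v := hv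
  have h_raise (k : ℕ) : h ((e ^ k) v) = (c + 2 * k) • (e ^ k) v := by
    induction k with
    | zero => simpa using hc
    | succ k ih =>
      rw [pow_succ', Module.End.mul_apply, he, ih, map_smul, ← add_smul]
      push_cast
      ring_nf
  have h_lower (k : ℕ) : h ((f ^ k) v) = (c - 2 * k) • (f ^ k) v := by
    induction k with
    | zero => simpa using hc
    | succ k ih =>
      rw [pow_succ', Module.End.mul_apply, hf, ih, map_smul, ← add_smul]
      push_cast
      ring_nf
  have ef_lower (k : ℕ) : e (f ((f ^ k) v)) = (μ + k * c - k * (k + 1)) • (f ^ k) v := by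
    induction k with
    | zero => simpa using hv
    | succ k ih =>
      rw [hef, h_lower, pow_succ', Module.End.mul_apply, ih, map_smul, ← add_smul]
      push_cast
      ring_nf
  have fe_raise (k : ℕ) : f (e ((e ^ k) v)) = (μ - (k + 1) * c - k * (k + 1)) • (e ^ k) v := by
    have hfe (x : V) : f (e x) = e (f x) - h x := eq_sub_of_add_eq (hef x).symm
    induction k with
    | zero => simp [hfe, hv, hc, sub_smul]
    | succ k ih =>
      rw [hfe, h_raise, pow_succ', Module.End.mul_apply, ih, map_smul, ← sub_smul]
      push_cast
      ring_nf
  obtain ⟨n, hn, hn'⟩ := Nat.exists_not_and_succ_of_not_zero_of_exists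
    (p := fun k ↦ (e ^ k) v = 0) (by simpa using hv0)
    (h.exists_eq_zero_of_apply_eq_smul (fun k ↦ c + 2 * k) (fun a b ↦ by simp) _ h_raise)
  obtain ⟨l, hl, hl'⟩ := Nat.exists_not_and_succ_of_not_zero_of_exists
    (p := fun k ↦ (f ^ k) v = 0) (by simpa using hv0)
    (h.exists_eq_zero_of_apply_eq_smul (fun k ↦ c - 2 * k) (fun a b ↦ by simp) _ h_lower)
  rw [pow_succ', Module.End.mul_apply] at hn' hl'
  have top : μ - (n + 1) * c - n * (n + 1) = 0 := by
    have := fe_raise n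
    rw [hn', map_zero, eq_comm, smul_eq_zero] at this
    exact this.resolve_right hn
  have bot : μ + l * c - l * (l + 1) = 0 := by
    have := ef_lower l
    rw [hl', map_zero, eq_comm, smul_eq_zero] at this
    exact this.resolve_right hl
  have hnl : (n + 1 + l : ℂ) ≠ 0 := by
    exact_mod_cast (by omega : n + 1 + l ≠ 0)
  have hμ_eq : μ = ((n + 1) * l : ℕ) := by
    apply mul_left_cancel₀ hnl
    push_cast
    linear_combination l * top + (n + 1) * bot
  refine ⟨(n + 1) * l, Nat.pos_of_ne_zero fun h0 ↦ hμ0 ?_, hμ_eq⟩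
  rw [hμ_eq, h0, Nat.cast_zero]
end
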